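/- Let α, β > −1, N ≥ 1, let −1 < z_{1,N} < ... < z_{N,N} < 1 be the ordered roots of the Jacobi polynomial P_N^{(α,β)}, and let M = max_{j=1,...,N} 2j(2N + α + β + 1 − j). Then the largest root satisfies 1 − z_{N,N} ≥ 8(α+1)/( M + 4(α+1) + sqrt(M² − 16(α+1)(β+1)) ) ≥ 4(α+1)/(M + 2(α+1)), and the smallest root satisfies 1 + z_{1,N} ≥ 8(β+1)/( M + 4(β+1) + sqrt(M² − 16(α+1)(β+1)) ) ≥ 4(β+1)/(M + 2(β+1)). -/

import Mathlib

/-- The Jacobi polynomials `P_n^{(a,b)}`, orthogonal w.r.t. the weight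
`(1-x)^a·(1+x)^b` on `(-1,1)` (for `a, b > -1`), defined via the standard
three-term recurrence
`P_0 = 1`, `P_1 = (a-b)/2 + ((a+b+2)/2)·X`, and for `n ≥ 2`:
`2n(n+a+b)(2n+a+b-2)·P_n
  = (2n+a+b-1)·[(2n+a+b)(2n+a+b-2)·X + a²-b²]·P_{n-1}
    - 2(n+a-1)(n+b-1)(2n+a+b)·P_{n-2}`. -/
noncomputable def jacobiP (a b : ℝ) : ℕ → Polynomial ℝ
  | 0 => 1
  | 1 => Polynomial.C ((a - b) / 2) + Polynomial.C ((a + b + 2) / 2) * Polynomial.X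
  | n + 2 =>
      Polynomial.C
          (1 / (2 * ((n : ℝ) + 2) * (((n : ℝ) + 2) + a + b)
            * (2 * ((n : ℝ) + 2) + a + b - 2))) *
        (Polynomial.C (2 * ((n : ℝ) + 2) + a + b - 1) *
            ((Polynomial.C ((2 * ((n : ℝ) + 2) + a + b)
                * (2 * ((n : ℝ) + 2) + a + b - 2)) * Polynomial.X
              + Polynomial.C (a ^ 2 - b ^ 2)) * jacobiP a b (n + 1))
          - Polynomial.C (2 * (((n : ℝ) + 2) + a - 1) * (((n : ℝ) + 2) + b - 1)
              * (2 * ((n : ℝ) + 2) + a + b)) * jacobiP a b n)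

open Polynomial in
/-- Laguerre's inequality for products of real linear factors. -/
theorem laguerre_inequality_prod {ι : Type*} (s : Finset ι) (z : ι → ℝ) (x : ℝ) :
    (∏ i ∈ s, (X - C (z i))).eval x * (derivative (derivative (∏ i ∈ s, (X - C (z i))))).eval x
      ≤ ((derivative (∏ i ∈ s, (X - C (z i)))).eval x) ^ 2 := by
  classical
  induction s using Finset.induction_on with
  | empty => simp
  | insert i s hi ih =>
    rw [Finset.prod_insert hi]
    generalize (∏ i ∈ s, (X - C (z i))) = h at ih ⊢
    simp only [derivative_mul, derivative_add, derivative_sub, derivative_X, derivative_C, eval_add,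
      eval_mul, eval_sub, eval_X, eval_C, sub_zero, one_mul]
    nlinarith [mul_nonneg (sq_nonneg (x - z i)) (sub_nonneg.2 ih), sq_nonneg (h.eval x)]

open Polynomial in
/-- At a simple root of a real-rooted polynomial, Laguerre's inequality for the cofactor. -/
theorem laguerre_inequality_at_root {N : ℕ} (p : ℝ[X]) (hp : p ≠ 0) (hdeg : p.natDegree ≤ N)
    (z : Fin N → ℝ) (hz : Function.Injective z) (hroot : ∀ i, p.eval (z i) = 0) (j : Fin N) :
    (derivative p).eval (z j) ≠ 0 ∧
      4 * (derivative p).eval (z j) * (derivative (derivative (derivative p))).eval (z j)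
        ≤ 3 * ((derivative (derivative p)).eval (z j)) ^ 2 := by
  classical
  have hdvd : (∏ i, (X - C (z i))) ∣ p :=
    Finset.prod_dvd_of_coprime
      (fun i _ k _ hik => pairwise_coprime_X_sub_C hz hik)
      (fun i _ => dvd_iff_isRoot.2 (hroot i))
  obtain ⟨r, hr⟩ := hdvd
  have hmonic : (∏ i, (X - C (z i))).Monic := monic_prod_of_monic _ _ fun i _ => monic_X_sub_C _
  have hr0 : r ≠ 0 := by rintro rfl; exact hp (by simpa using hr)
  have hrdeg : r.natDegree = 0 := by
    have h1 := hmonic.natDegree_mul' hr0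
    rw [← hr, natDegree_prod_of_monic _ _ fun i _ => monic_X_sub_C _] at h1
    simp at h1
    omega
  obtain ⟨c, rfl⟩ := natDegree_eq_zero.1 hrdeg
  have hc : c ≠ 0 := by rintro rfl; simp at hr0
  rw [← Finset.mul_prod_erase _ _ (Finset.mem_univ j)] at hr
  have hL := laguerre_inequality_prod (Finset.univ.erase j) z (z j)
  have hg : (∏ i ∈ Finset.univ.erase j, (X - C (z i))).eval (z j) ≠ 0 := by
    rw [eval_prod, Finset.prod_ne_zero_iff]
    intro i hi
    simpa [sub_eq_zero] using fun h => (Finset.ne_of_mem_erase hi) (hz h).symm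
  generalize (∏ i ∈ Finset.univ.erase j, (X - C (z i))) = g at hr hL hg
  subst hr
  simp only [derivative_mul, derivative_add, derivative_sub, derivative_X, derivative_C, eval_add,
      eval_mul, eval_sub, eval_X, eval_C, sub_zero, one_mul, mul_zero, zero_mul,
      sub_self, add_zero]
  refine ⟨mul_ne_zero hg hc, ?_⟩
  nlinarith [mul_nonneg (sq_nonneg c) (sub_nonneg.2 hL)]

section Jacobi

open Polynomial

variable {a b : ℝ}

theorem jacobiP_recurrence (ha : -1 < a) (hb : -1 < b) (n : ℕ) :
    C (2 * ((n : ℝ) + 2) * (n + 2 + a + b) * (2 * n + 2 + a + b)) * jacobiP a b (n + 2)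
      = C (2 * (n : ℝ) + 3 + a + b) * ((C ((2 * (n : ℝ) + 4 + a + b) * (2 * n + 2 + a + b)) * X
            + C (a ^ 2 - b ^ 2)) * jacobiP a b (n + 1))
          - C (2 * ((n : ℝ) + 1 + a) * (n + 1 + b) * (2 * n + 4 + a + b)) * jacobiP a b n := by
  have hn : (0 : ℝ) ≤ n := n.cast_nonneg
  have h : 2 * ((n : ℝ) + 2) * (n + 2 + a + b) * (2 * n + 2 + a + b) ≠ 0 :=
    (mul_pos (mul_pos (by linarith) (by linarith)) (by linarith)).ne'
  rw [jacobiP, ← mul_assoc, ← C_mul,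
    show (2 * ((n : ℝ) + 2) * (n + 2 + a + b) * (2 * n + 2 + a + b)) *
      (1 / (2 * ((n : ℝ) + 2) * (((n : ℝ) + 2) + a + b) * (2 * ((n : ℝ) + 2) + a + b - 2))) = 1 by
      rw [show 2 * ((n : ℝ) + 2) + a + b - 2 = 2 * n + 2 + a + b by ring]
      exact mul_one_div_cancel h, C_1, one_mul]
  ring_nf

theorem jacobiP_natDegree_le (n : ℕ) :
    (jacobiP a b n).natDegree ≤ n ∧ (jacobiP a b (n + 1)).natDegree ≤ n + 1 := by
  induction n with
  | zero =>
    refine ⟨by simp [jacobiP], ?_⟩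
    simp only [jacobiP]
    compute_degree
  | succ n ih =>
    refine ⟨ih.2, ?_⟩
    rw [jacobiP]
    refine (natDegree_C_mul_le _ _).trans ((natDegree_sub_le _ _).trans (max_le ?_ ?_))
    · refine (natDegree_C_mul_le _ _).trans (natDegree_mul_le.trans ?_)
      rw [add_comm (n + 1) 1]
      refine Nat.add_le_add ?_ ih.2
      compute_degree
    · exact (natDegree_C_mul_le _ _).trans (ih.1.trans (by omega))

theorem jacobiP_coeff_self_pos (ha : -1 < a) (hb : -1 < b) (n : ℕ) :
    0 < (jacobiP a b n).coeff n ∧ 0 < (jacobiP a b (n + 1)).coeff (n + 1) := by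
  induction n with
  | zero => simp [jacobiP, coeff_one]; linarith
  | succ n ih =>
    refine ⟨ih.2, ?_⟩
    have hn : (0 : ℝ) ≤ n := n.cast_nonneg
    have h := congrArg (fun p => p.coeff (n + 2)) (jacobiP_recurrence ha hb n)
    have h1 : (jacobiP a b (n + 1)).coeff (n + 2) = 0 :=
      coeff_eq_zero_of_natDegree_lt (lt_of_le_of_lt (jacobiP_natDegree_le n).2 (by omega))
    have h0 : (jacobiP a b n).coeff (n + 2) = 0 :=
      coeff_eq_zero_of_natDegree_lt (lt_of_le_of_lt (jacobiP_natDegree_le n).1 (by omega))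
    simp only [coeff_sub, coeff_C_mul, add_mul, coeff_add, mul_assoc (C _) X, coeff_X_mul,
      h1, h0, mul_zero, add_zero, sub_zero] at h
    have hl : 0 < 2 * ((n : ℝ) + 2) * (n + 2 + a + b) * (2 * n + 2 + a + b) :=
      mul_pos (mul_pos (by linarith) (by linarith)) (by linarith)
    have hr : 0 < (2 * (n : ℝ) + 3 + a + b) * ((2 * n + 4 + a + b) * (2 * n + 2 + a + b)) *
        (jacobiP a b (n + 1)).coeff (n + 1) :=
      mul_pos (mul_pos (by linarith) (mul_pos (by linarith) (by linarith))) ih.2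
    refine pos_of_mul_pos_right (hr.trans_eq ?_) hl.le
    linear_combination -h

/-- The two first-order structure relations between consecutive Jacobi polynomials. -/
theorem jacobiP_structure (ha : -1 < a) (hb : -1 < b) (n : ℕ) :
    (C (2 * (n : ℝ) + 2 + a + b) * ((1 - X ^ 2) * derivative (jacobiP a b (n + 1)))
      = C ((n : ℝ) + 1) * (C (a - b) - C (2 * (n : ℝ) + 2 + a + b) * X) * jacobiP a b (n + 1)
        + C (2 * ((n : ℝ) + 1 + a) * (n + 1 + b)) * jacobiP a b n) ∧
    (C (2 * (n : ℝ) + 2 + a + b) * ((1 - X ^ 2) * derivative (jacobiP a b n))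
      = C ((n : ℝ) + 1 + a + b) * (C (a - b) + C (2 * (n : ℝ) + 2 + a + b) * X) * jacobiP a b n
        - C (2 * ((n : ℝ) + 1) * (n + 1 + a + b)) * jacobiP a b (n + 1)) := by
  induction n with
  | zero =>
    constructor <;> refine Polynomial.funext fun x => ?_ <;> simp [jacobiP] <;> ring
  | succ n ih =>
    have hn : (0 : ℝ) ≤ n := n.cast_nonneg
    have hs : (2 * (n : ℝ) + 2 + a + b) ≠ 0 := by linarith
    have hl : 2 * ((n : ℝ) + 2) * (n + 2 + a + b) * (2 * n + 2 + a + b) ≠ 0 :=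
      (mul_pos (mul_pos (by linarith) (by linarith)) (by linarith)).ne'
    have hrec := jacobiP_recurrence ha hb n
    have hrec' := congrArg derivative hrec
    obtain ⟨hD, hU⟩ := ih
    constructor <;> refine Polynomial.funext fun x => ?_
    · replace hrec := congrArg (eval x) hrec
      replace hrec' := congrArg (eval x) hrec'
      replace hD := congrArg (eval x) hD
      replace hU := congrArg (eval x) hU
      simp only [derivative_mul, derivative_add, derivative_sub, derivative_X, derivative_C,
        eval_add, eval_mul, eval_sub, eval_X, eval_C, eval_pow, eval_one, zero_mul,
        zero_add, add_zero, mul_one] at hrec hrec' hD hU ⊢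
      push_cast
      refine mul_left_cancel₀ (mul_ne_zero hl hs) ?_
      generalize eval x (derivative (jacobiP a b (n + 1 + 1))) = R' at *
      generalize eval x (jacobiP a b (n + 1 + 1)) = R at *
      generalize eval x (derivative (jacobiP a b (n + 1))) = Q' at *
      generalize eval x (jacobiP a b (n + 1)) = Q at *
      generalize eval x (derivative (jacobiP a b n)) = P' at *
      generalize eval x (jacobiP a b n) = P at *
      generalize (n : ℝ) = n at *
      linear_combination (2 * n + 2 + a + b) * (2 * n + 4 + a + b) * (1 - x ^ 2) * hrec'
        + (2 * n + 4 + a + b) * (2 * n + 3 + a + b) *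
          ((2 * n + 4 + a + b) * (2 * n + 2 + a + b) * x + (a ^ 2 - b ^ 2)) * hD
        - (2 * n + 4 + a + b) * (2 * (n + 1 + a) * (n + 1 + b) * (2 * n + 4 + a + b)) * hU
        - (2 * n + 2 + a + b) * ((n + 2) * ((a - b) - (2 * n + 4 + a + b) * x)) * hrec
    · replace hrec := congrArg (eval x) hrec
      replace hD := congrArg (eval x) hD
      simp only [eval_add, eval_mul, eval_sub, eval_X, eval_C, eval_pow, eval_one] at hrec hD ⊢
      push_cast
      refine mul_left_cancel₀ hs ?_
      generalize eval x (jacobiP a b (n + 1 + 1)) = R at *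
      generalize eval x (derivative (jacobiP a b (n + 1))) = Q' at *
      generalize eval x (jacobiP a b (n + 1)) = Q at *
      generalize eval x (jacobiP a b n) = P at *
      generalize (n : ℝ) = n at *
      linear_combination (2 * n + 4 + a + b) * hD + hrec

/-- The Jacobi differential equation. -/
theorem jacobiP_ode (ha : -1 < a) (hb : -1 < b) (n : ℕ) :
    (1 - X ^ 2) * derivative (derivative (jacobiP a b n))
      + (C (b - a) - C (a + b + 2) * X) * derivative (jacobiP a b n)
      + C ((n : ℝ) * (n + a + b + 1)) * jacobiP a b n = 0 := by
  cases n with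
  | zero => simp [jacobiP]
  | succ n =>
    have hn : (0 : ℝ) ≤ n := n.cast_nonneg
    have hs : (2 * (n : ℝ) + 2 + a + b) ≠ 0 := by linarith
    obtain ⟨hD, hU⟩ := jacobiP_structure ha hb n
    have hD' := congrArg derivative hD
    have hX : (1 - X ^ 2 : ℝ[X]) ≠ 0 := fun h => by simpa using congrArg (eval 0) h
    refine mul_left_cancel₀ hX (Polynomial.funext fun x => ?_)
    replace hD := congrArg (eval x) hD
    replace hD' := congrArg (eval x) hD'
    replace hU := congrArg (eval x) hU
    simp only [derivative_mul, derivative_add, derivative_sub, derivative_X, derivative_C,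
      derivative_one, derivative_X_pow, Nat.cast_ofNat, Nat.add_one_sub_one, pow_one,
      eval_add, eval_mul, eval_sub, eval_X, eval_C, eval_pow, eval_one, eval_zero, zero_mul,
      zero_add, mul_one, zero_sub, eval_neg, mul_zero] at hD hD' hU ⊢
    push_cast
    refine mul_left_cancel₀ (pow_ne_zero 2 hs) ?_
    generalize eval x (derivative (derivative (jacobiP a b (n + 1)))) = Q'' at *
    generalize eval x (derivative (jacobiP a b (n + 1))) = Q' at *
    generalize eval x (jacobiP a b (n + 1)) = Q at *
    generalize eval x (derivative (jacobiP a b n)) = P' at *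
    generalize eval x (jacobiP a b n) = P at *
    generalize (n : ℝ) = n at *
    linear_combination (2 * n + 2 + a + b) * (1 - x ^ 2) * hD'
      + 2 * (n + 1 + a) * (n + 1 + b) * hU
      + ((2 * n + 2 + a + b) * (b - a - (a + b) * x)
        + (n + 1) * (a - b - (2 * n + 2 + a + b) * x)) * hD

/-- The bound satisfied by every zero of a Jacobi polynomial. -/
theorem jacobiP_root_bound (ha : -1 < a) (hb : -1 < b) {N : ℕ} (z : Fin N → ℝ)
    (hz : Function.Injective z) (hroot : ∀ i, (jacobiP a b N).eval (z i) = 0) (j : Fin N)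
    (hj : z j ∈ Set.Ioo (-1 : ℝ) 1) :
    (a + 1) * (1 + z j) ^ 2 + (b + 1) * (1 - z j) ^ 2
      ≤ (N : ℝ) * (N + a + b + 1) * (1 - z j ^ 2) := by
  have hp : jacobiP a b N ≠ 0 := fun h => by
    simpa [h] using (jacobiP_coeff_self_pos ha hb N).1
  obtain ⟨h1, hL⟩ := laguerre_inequality_at_root _ hp (jacobiP_natDegree_le N).1 z hz hroot j
  have hode := jacobiP_ode ha hb N
  have hode' := congrArg (eval (z j)) (congrArg derivative hode)
  replace hode := congrArg (eval (z j)) hode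
  have hr := hroot j
  simp only [derivative_mul, derivative_add, derivative_sub, derivative_X, derivative_C,
    derivative_one, derivative_X_pow, Nat.cast_ofNat, Nat.add_one_sub_one, pow_one,
    derivative_zero, eval_add, eval_mul, eval_sub, eval_X, eval_C, eval_pow, eval_one, eval_zero,
    zero_mul, zero_add, add_zero, mul_one, zero_sub, eval_neg, hr, mul_zero] at hode hode'
  generalize eval (z j) (derivative (derivative (derivative (jacobiP a b N)))) = p3 at *
  generalize eval (z j) (derivative (derivative (jacobiP a b N))) = p2 at *
  generalize eval (z j) (derivative (jacobiP a b N)) = p1 at *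
  generalize z j = x at *
  generalize (N : ℝ) = n at *
  obtain ⟨hx1, hx2⟩ := hj
  set q := b - a - (a + b + 2) * x with hq
  have hsq : 0 < p1 ^ 2 := by positivity
  have key : 0 ≤ p1 ^ 2 *
      (4 * ((1 - x ^ 2) * (n * (n + a + b + 1) - (a + b + 2)) + 2 * x * q) - q ^ 2) := by
    have h := mul_nonneg (sq_nonneg (1 - x ^ 2)) (sub_nonneg.2 hL)
    refine h.trans_eq ?_
    linear_combination (3 * ((1 - x ^ 2) * p2 - q * p1) + 4 * p1 * (q - 2 * x)) * hode
      - 4 * (1 - x ^ 2) * p1 * hode'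
  nlinarith [nonneg_of_mul_nonneg_right key hsq, sq_nonneg q]

end Jacobi

theorem quadratic_bound_of_mul_le {A B M t : ℝ} (hA : 0 < A) (hB : 0 < B) (ht0 : 0 < t)
    (ht2 : t < 2) (h : 2 * A * (2 - t) ^ 2 + 2 * B * t ^ 2 ≤ M * (t * (2 - t))) :
    t ≥ 8 * A / (M + 4 * A + Real.sqrt (M ^ 2 - 16 * A * B)) ∧
      8 * A / (M + 4 * A + Real.sqrt (M ^ 2 - 16 * A * B)) ≥ 4 * A / (M + 2 * A) := by
  have hw : 0 < t * (2 - t) := mul_pos ht0 (by linarith)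
  have hAB := mul_pos hA hB
  have hM : 0 < M := by
    refine pos_of_mul_pos_left (lt_of_lt_of_le ?_ h) hw.le
    positivity
  have hsq : (M + 2 * A + 2 * B) * t ^ 2 - 2 * (M + 4 * A) * t + 8 * A ≤ 0 := by linarith
  have hK : 0 < M + 2 * A + 2 * B := by linarith
  have hd : ((M + 2 * A + 2 * B) * t - (M + 4 * A)) ^ 2 ≤ M ^ 2 - 16 * A * B := by
    nlinarith [mul_nonneg hK.le (neg_nonneg.2 hsq)]
  have hD := Real.sq_sqrt ((sq_nonneg _).trans hd)
  have hDM : Real.sqrt (M ^ 2 - 16 * A * B) ≤ M :=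
    Real.sqrt_le_iff.2 ⟨hM.le, by nlinarith⟩
  have hlow := (abs_le.1 (Real.abs_le_sqrt hd)).1
  have hD0 := Real.sqrt_nonneg (M ^ 2 - 16 * A * B)
  generalize Real.sqrt (M ^ 2 - 16 * A * B) = D at *
  constructor
  · rw [ge_iff_le, div_le_iff₀ (by positivity)]
    refine le_of_mul_le_mul_left ?_ hK
    nlinarith [mul_nonneg (sub_nonneg.2 hlow) (by positivity : 0 ≤ M + 4 * A + D)]
  · rw [ge_iff_le, div_le_div_iff₀ (by positivity) (by positivity)]
    nlinarith [mul_nonneg hA.le (sub_nonneg.2 hDM)]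

/-- For the ordered roots `-1 < z 0 < … < z (N-1) < 1` of the Jacobi
polynomial `P_N^{(α,β)}` (`α, β > -1`, `N ≥ 1`), with
`M = max_{j=1,…,N} 2j(2N+α+β+1-j)`, the largest root satisfies
`1 - z (N-1) ≥ 8(α+1)/(M + 4(α+1) + √(M² - 16(α+1)(β+1))) ≥ 4(α+1)/(M + 2(α+1))`
and the smallest root satisfies
`1 + z 0 ≥ 8(β+1)/(M + 4(β+1) + √(M² - 16(α+1)(β+1))) ≥ 4(β+1)/(M + 2(β+1))`. -/
theorem jacobi_extreme_roots_bound
    (α β : ℝ) (hα : -1 < α) (hβ : -1 < β) (N : ℕ) (hN : 1 ≤ N)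
    (z : Fin N → ℝ) (hz : StrictMono z)
    (hmem : ∀ i, z i ∈ Set.Ioo (-1 : ℝ) 1)
    (hroot : ∀ i, (jacobiP α β N).eval (z i) = 0) (M : ℝ)
    (hM : IsGreatest
      ((fun j : ℕ => 2 * (j : ℝ) * (2 * (N : ℝ) + α + β + 1 - (j : ℝ))) ''
        Set.Icc 1 N) M) :
    (1 - z ⟨N - 1, Nat.sub_lt (by omega) one_pos⟩
        ≥ 8 * (α + 1)
            / (M + 4 * (α + 1) + Real.sqrt (M ^ 2 - 16 * (α + 1) * (β + 1))))
      ∧ (8 * (α + 1)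
            / (M + 4 * (α + 1) + Real.sqrt (M ^ 2 - 16 * (α + 1) * (β + 1)))
          ≥ 4 * (α + 1) / (M + 2 * (α + 1)))
      ∧ (1 + z ⟨0, by omega⟩
          ≥ 8 * (β + 1)
              / (M + 4 * (β + 1) + Real.sqrt (M ^ 2 - 16 * (α + 1) * (β + 1))))
      ∧ (8 * (β + 1)
            / (M + 4 * (β + 1) + Real.sqrt (M ^ 2 - 16 * (α + 1) * (β + 1)))
          ≥ 4 * (β + 1) / (M + 2 * (β + 1))) := by
  have hMN : 2 * ((N : ℝ) * (N + α + β + 1)) ≤ M := by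
    have h := hM.2 (Set.mem_image_of_mem _ (Set.mem_Icc.2 ⟨hN, le_refl N⟩))
    linarith
  have key (j : Fin N) :
      2 * (α + 1) * (1 + z j) ^ 2 + 2 * (β + 1) * (1 - z j) ^ 2 ≤ M * (1 - z j ^ 2) := by
    have h := jacobiP_root_bound hα hβ z hz.injective hroot j (hmem j)
    have hw : 0 ≤ 1 - z j ^ 2 := by nlinarith [(hmem j).1, (hmem j).2]
    nlinarith [mul_le_mul_of_nonneg_right hMN hw]
  have hA : 0 < α + 1 := by linarith
  have hB : 0 < β + 1 := by linarith
  have hlast := hmem ⟨N - 1, Nat.sub_lt (by omega) one_pos⟩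
  have hfirst := hmem ⟨0, by omega⟩
  have h1 := quadratic_bound_of_mul_le (M := M) hA hB (sub_pos.2 hlast.2)
    (by linarith [hlast.1]) (by linarith [key ⟨N - 1, Nat.sub_lt (by omega) one_pos⟩])
  have h2 := quadratic_bound_of_mul_le (M := M) (t := 1 + z ⟨0, by omega⟩) hB hA
    (by linarith [hfirst.1]) (by linarith [hfirst.2]) (by linarith [key ⟨0, by omega⟩])
  rw [mul_right_comm 16 (β + 1) (α + 1)] at h2
  exact ⟨h1.1, h1.2, h2.1, h2.2⟩
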